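/- Let n ≥ 2 and define m̃(ξ', ξ_{n+1}) = ∫_{1≤|t|≤2} K(t) e^{−2πi(t·ξ' + |t|²ξ_{n+1})} dt for (ξ', ξ_{n+1}) ∈ ℝ^n × ℝ, where K is a C¹ function on {1 ≤ |t| ≤ 2} satisfying |K(t)| ≤ A|t|^{−n} and |∇K(t)| ≤ A|t|^{−n−1}. Then |m̃(ξ)| ≤ C(‖ξ‖)^{−1/2}, where ‖ξ‖ = |ξ'| + |ξ_{n+1}|^{1/2} and C depends only on n and A. -/

import Mathlib

open MeasureTheory

theorem hasDerivAt_cexp_quadratic (p q r : ℝ) :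
    HasDerivAt (fun r : ℝ => Complex.exp (Complex.I * ((p * r + q * r ^ 2 : ℝ) : ℂ)))
      (Complex.exp (Complex.I * ((p * r + q * r ^ 2 : ℝ) : ℂ)) *
        (Complex.I * ((p + 2 * q * r : ℝ) : ℂ))) r := by
  have h : HasDerivAt (fun r : ℝ => p * r + q * r ^ 2) (p + 2 * q * r) r := by
    have h₁ := ((hasDerivAt_id r).const_mul p).add (((hasDerivAt_id r).pow 2).const_mul q)
    refine h₁.congr_deriv ?_
    simp
    ring
  exact (h.ofReal_comp.const_mul Complex.I).cexp

theorem norm_cexp_I_mul_ofReal (x : ℝ) : ‖Complex.exp (Complex.I * (x : ℂ))‖ = 1 := by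
  rw [mul_comm, Complex.norm_exp_ofReal_mul_I]

theorem continuous_cexp_quadratic (p q : ℝ) :
    Continuous fun r : ℝ => Complex.exp (Complex.I * ((p * r + q * r ^ 2 : ℝ) : ℂ)) := by
  fun_prop

/-- First derivative test for quadratic phases. -/
theorem norm_integral_cexp_quadratic_le_of_le_abs_deriv {p q α β μ : ℝ} (hμ : 0 < μ) (hαβ : α ≤ β)
    (h : ∀ r ∈ Set.Icc α β, μ ≤ |p + 2 * q * r|) :
    ‖∫ r in α..β, Complex.exp (Complex.I * ((p * r + q * r ^ 2 : ℝ) : ℂ))‖ ≤ 4 / μ := by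
  have hne : ∀ r ∈ Set.uIcc α β, p + 2 * q * r ≠ 0 := by
    intro r hr
    rw [Set.uIcc_of_le hαβ] at hr
    exact abs_pos.1 (hμ.trans_le (h r hr))
  have hd : ∀ r, HasDerivAt (fun r : ℝ => p + 2 * q * r) (2 * q) r := fun r => by
    simpa using ((hasDerivAt_id r).const_mul (2 * q)).const_add p
  have hinv : ∀ r ∈ Set.uIcc α β,
      HasDerivAt (fun r : ℝ => (p + 2 * q * r)⁻¹) (-(2 * q) / (p + 2 * q * r) ^ 2) r :=
    fun r hr => (hd r).inv (hne r hr)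
  have hcont : ContinuousOn (fun r : ℝ => -(2 * q) / (p + 2 * q * r) ^ 2) (Set.uIcc α β) :=
    ContinuousOn.div (by fun_prop) (by fun_prop) fun r hr => pow_ne_zero 2 (hne r hr)
  have hFTC := intervalIntegral.integral_eq_sub_of_hasDerivAt hinv hcont.intervalIntegrable
  have hu : ∀ r ∈ Set.uIcc α β,
      HasDerivAt (fun r : ℝ => -Complex.I * (((p + 2 * q * r)⁻¹ : ℝ) : ℂ))
        (-Complex.I * ((-(2 * q) / (p + 2 * q * r) ^ 2 : ℝ) : ℂ)) r :=
    fun r hr => (hinv r hr).ofReal_comp.const_mul _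
  have hibp := intervalIntegral.integral_mul_deriv_eq_deriv_mul hu
    (fun r _ => hasDerivAt_cexp_quadratic p q r)
    (ContinuousOn.intervalIntegrable
      (continuousOn_const.mul (Complex.continuous_ofReal.comp_continuousOn hcont)))
    (Continuous.intervalIntegrable (by fun_prop) _ _)
  have hlhs : ∫ r in α..β, Complex.exp (Complex.I * ((p * r + q * r ^ 2 : ℝ) : ℂ)) =
      ∫ r in α..β, (-Complex.I * (((p + 2 * q * r)⁻¹ : ℝ) : ℂ)) *
        (Complex.exp (Complex.I * ((p * r + q * r ^ 2 : ℝ) : ℂ)) *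
          (Complex.I * ((p + 2 * q * r : ℝ) : ℂ))) := by
    refine intervalIntegral.integral_congr fun r hr => ?_
    have h₀ : ((p + 2 * q * r : ℝ) : ℂ) ≠ 0 := Complex.ofReal_ne_zero.2 (hne r hr)
    generalize Complex.exp (Complex.I * ((p * r + q * r ^ 2 : ℝ) : ℂ)) = e
    simp only [Complex.ofReal_inv]
    generalize ((p + 2 * q * r : ℝ) : ℂ) = z at h₀
    rw [show -Complex.I * z⁻¹ * (e * (Complex.I * z)) =
      -(Complex.I * Complex.I) * e * (z⁻¹ * z) by ring, Complex.I_mul_I, inv_mul_cancel₀ h₀]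
    ring
  have hbd : ∀ r ∈ Set.Icc α β, |(p + 2 * q * r)⁻¹| ≤ 1 / μ := by
    intro r hr
    rw [abs_inv, ← one_div]
    exact one_div_le_one_div_of_le hμ (h r hr)
  have hbdu : ∀ r ∈ Set.Icc α β,
      ‖(-Complex.I * (((p + 2 * q * r)⁻¹ : ℝ) : ℂ)) *
        Complex.exp (Complex.I * ((p * r + q * r ^ 2 : ℝ) : ℂ))‖ ≤ 1 / μ := by
    intro r hr
    rw [norm_mul, norm_cexp_I_mul_ofReal, mul_one, norm_mul, norm_neg, Complex.norm_I, one_mul,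
      Complex.norm_real]
    exact hbd r hr
  obtain ⟨c, hc, hcq⟩ : ∃ c : ℝ, |c| = 1 ∧ |q| = c * -q := by
    rcases abs_cases q with hq | hq
    · exact ⟨-1, by norm_num, by linarith [hq.1]⟩
    · exact ⟨1, by norm_num, by linarith [hq.1]⟩
  have hrem : ‖∫ r in α..β, (-Complex.I * ((-(2 * q) / (p + 2 * q * r) ^ 2 : ℝ) : ℂ)) *
      Complex.exp (Complex.I * ((p * r + q * r ^ 2 : ℝ) : ℂ))‖ ≤ 2 / μ := by
    refine (intervalIntegral.norm_integral_le_integral_norm hαβ).trans ?_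
    have heq : ∫ r in α..β, ‖(-Complex.I * ((-(2 * q) / (p + 2 * q * r) ^ 2 : ℝ) : ℂ)) *
        Complex.exp (Complex.I * ((p * r + q * r ^ 2 : ℝ) : ℂ))‖ =
        ∫ r in α..β, c * (-(2 * q) / (p + 2 * q * r) ^ 2) := by
      refine intervalIntegral.integral_congr fun r hr => ?_
      rw [norm_mul, norm_cexp_I_mul_ofReal, mul_one, norm_mul, norm_neg, Complex.norm_I, one_mul,
        Complex.norm_real, Real.norm_eq_abs, abs_div, abs_neg, abs_mul, hcq, abs_two,
        abs_of_nonneg (sq_nonneg _)]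
      ring
    rw [heq, intervalIntegral.integral_const_mul, hFTC]
    refine (le_abs_self _).trans ?_
    rw [abs_mul, hc, one_mul]
    refine (abs_sub _ _).trans ?_
    have := hbd β ⟨hαβ, le_rfl⟩
    have := hbd α ⟨le_rfl, hαβ⟩
    have : 2 / μ = 1 / μ + 1 / μ := by ring
    linarith
  rw [hlhs, hibp]
  refine (norm_sub_le _ _).trans ?_
  refine (add_le_add (norm_sub_le _ _) hrem).trans ?_
  have := hbdu β ⟨hαβ, le_rfl⟩
  have := hbdu α ⟨le_rfl, hαβ⟩
  have : 4 / μ = 1 / μ + 1 / μ + 2 / μ := by ring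
  linarith

theorem norm_integral_cexp_quadratic_le_length {p q α β : ℝ} (hαβ : α ≤ β) :
    ‖∫ r in α..β, Complex.exp (Complex.I * ((p * r + q * r ^ 2 : ℝ) : ℂ))‖ ≤ β - α := by
  have := intervalIntegral.norm_integral_le_of_norm_le_const (a := α) (b := β) (C := 1)
    (f := fun r : ℝ => Complex.exp (Complex.I * ((p * r + q * r ^ 2 : ℝ) : ℂ)))
    fun r _ => (norm_cexp_I_mul_ofReal _).le
  rwa [one_mul, abs_of_nonneg (sub_nonneg.2 hαβ)] at this

/-- Second derivative test for quadratic phases. -/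
theorem norm_integral_cexp_quadratic_le_div_sqrt {p q α β : ℝ} (hq : q ≠ 0) (hαβ : α ≤ β) :
    ‖∫ r in α..β, Complex.exp (Complex.I * ((p * r + q * r ^ 2 : ℝ) : ℂ))‖ ≤ 6 / √|q| := by
  have hs : 0 < √|q| := Real.sqrt_pos.2 (abs_pos.2 hq)
  have hss : √|q| * √|q| = |q| := Real.mul_self_sqrt (abs_nonneg q)
  obtain ⟨r₀, hr₀⟩ : ∃ r₀ : ℝ, p = -(2 * q * r₀) := ⟨-p / (2 * q), by field_simp⟩
  have hderiv : ∀ r, |p + 2 * q * r| = 2 * |q| * |r - r₀| := by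
    intro r
    rw [← abs_two, ← abs_mul, ← abs_mul, hr₀]
    congr 1
    rw [abs_two]
    ring
  set δ := 1 / √|q| with hδ
  have hδ0 : 0 < δ := by positivity
  have hfar : ∀ r, δ ≤ |r - r₀| → 2 * √|q| ≤ |p + 2 * q * r| := by
    intro r hr
    rw [hderiv]
    calc 2 * √|q| = 2 * |q| * δ := by
          rw [hδ, mul_one_div, eq_div_iff hs.ne', mul_assoc, hss]
      _ ≤ _ := by gcongr
  set a := max α (min β (r₀ - δ)) with ha
  set b := max α (min β (r₀ + δ)) with hb
  have hαa : α ≤ a := le_max_left _ _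
  have hab : a ≤ b := max_le_max le_rfl (min_le_min le_rfl (by linarith))
  have hbβ : b ≤ β := max_le hαβ (min_le_left _ _)
  have hint : ∀ x y : ℝ, IntervalIntegrable
      (fun r : ℝ => Complex.exp (Complex.I * ((p * r + q * r ^ 2 : ℝ) : ℂ))) volume x y :=
    fun x y => (continuous_cexp_quadratic p q).intervalIntegrable x y
  have h₁ : ‖∫ r in α..a, Complex.exp (Complex.I * ((p * r + q * r ^ 2 : ℝ) : ℂ))‖ ≤
      4 / (2 * √|q|) := by
    rcases hαa.eq_or_lt with h | h
    · rw [← h, intervalIntegral.integral_same, norm_zero]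
      positivity
    · refine norm_integral_cexp_quadratic_le_of_le_abs_deriv (by positivity) hαa
        fun r hr => hfar r ?_
      have : a ≤ r₀ - δ := by
        rcases max_choice α (min β (r₀ - δ)) with h' | h'
        · exact absurd (ha.trans h') h.ne'
        · rw [ha, h']
          exact min_le_right _ _
      rw [abs_sub_comm]
      exact le_trans (by linarith [hr.2]) (le_abs_self _)
  have h₂ : ‖∫ r in a..b, Complex.exp (Complex.I * ((p * r + q * r ^ 2 : ℝ) : ℂ))‖ ≤ 2 * δ := by
    refine (norm_integral_cexp_quadratic_le_length hab).trans ?_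
    have : b ≤ a + 2 * δ := by
      refine max_le (by linarith) ?_
      have : min β (r₀ + δ) ≤ min β (r₀ - δ) + 2 * δ := by
        rcases min_choice β (r₀ - δ) with h' | h' <;> rw [h']
        · linarith [min_le_left β (r₀ + δ)]
        · linarith [min_le_right β (r₀ + δ)]
      linarith [le_max_right α (min β (r₀ - δ))]
    linarith
  have h₃ : ‖∫ r in b..β, Complex.exp (Complex.I * ((p * r + q * r ^ 2 : ℝ) : ℂ))‖ ≤
      4 / (2 * √|q|) := by
    rcases hbβ.eq_or_lt with h | h
    · rw [h, intervalIntegral.integral_same, norm_zero]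
      positivity
    · refine norm_integral_cexp_quadratic_le_of_le_abs_deriv (by positivity) hbβ
        fun r hr => hfar r ?_
      have : r₀ + δ ≤ b := by
        have hlt : min β (r₀ + δ) < β := (le_max_right _ _).trans_lt h
        have : min β (r₀ + δ) = r₀ + δ := (min_choice _ _).resolve_left hlt.ne
        rw [← this]
        exact le_max_right _ _
      exact le_trans (by linarith [hr.1]) (le_abs_self _)
  rw [← intervalIntegral.integral_add_adjacent_intervals (hint α b) (hint b β),
    ← intervalIntegral.integral_add_adjacent_intervals (hint α a) (hint a b)]
  refine norm_add₃_le.trans ((add_le_add (add_le_add h₁ h₂) h₃).trans (le_of_eq ?_))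
  rw [hδ]
  field_simp
  norm_num

theorem sqrt_one_add_le {x : ℝ} (hx : 0 ≤ x) : √(1 + x) ≤ 1 + √x := by
  rw [Real.sqrt_le_left (by positivity)]
  nlinarith [Real.sq_sqrt hx, Real.sqrt_nonneg x]

theorem norm_integral_cexp_quadratic_le_of_quadratic_coeff {p q α β : ℝ} (hα : 1 ≤ α)
    (hαβ : α ≤ β) (hβ : β ≤ 2) :
    ‖∫ r in α..β, Complex.exp (Complex.I * ((p * r + q * r ^ 2 : ℝ) : ℂ))‖ ≤
      7 / √(1 + |q|) := by
  have h₁ := norm_integral_cexp_quadratic_le_length (p := p) (q := q) hαβ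
  set N := ‖∫ r in α..β, Complex.exp (Complex.I * ((p * r + q * r ^ 2 : ℝ) : ℂ))‖
  have hN0 : 0 ≤ N := norm_nonneg _
  rw [le_div_iff₀ (by positivity)]
  have h₂ : N * √|q| ≤ 6 := by
    rcases eq_or_ne q 0 with h | h
    · simp [h]
    · exact (le_div_iff₀ (Real.sqrt_pos.2 (abs_pos.2 h))).1
        (norm_integral_cexp_quadratic_le_div_sqrt h hαβ)
  have := mul_le_mul_of_nonneg_left (sqrt_one_add_le (abs_nonneg q)) hN0
  linarith

theorem norm_integral_cexp_quadratic_le_of_linear_coeff {p q α β : ℝ} (hα : 1 ≤ α)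
    (hαβ : α ≤ β) (hβ : β ≤ 2) :
    ‖∫ r in α..β, Complex.exp (Complex.I * ((p * r + q * r ^ 2 : ℝ) : ℂ))‖ ≤
      21 / √(1 + |p|) := by
  rcases lt_or_ge |p| (8 * |q|) with h | h
  · refine (norm_integral_cexp_quadratic_le_of_quadratic_coeff hα hαβ hβ).trans ?_
    rw [div_le_div_iff₀ (by positivity) (by positivity)]
    have : √(1 + |p|) ≤ 3 * √(1 + |q|) := by
      rw [Real.sqrt_le_left (by positivity), mul_pow, Real.sq_sqrt (by positivity)]
      linarith [abs_nonneg q]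
    linarith
  · have h₁ := norm_integral_cexp_quadratic_le_length (p := p) (q := q) hαβ
    set N := ‖∫ r in α..β, Complex.exp (Complex.I * ((p * r + q * r ^ 2 : ℝ) : ℂ))‖
    have hN0 : 0 ≤ N := norm_nonneg _
    rw [le_div_iff₀ (by positivity)]
    have h₂ : N * √|p| ≤ 8 := by
      rcases le_or_gt |p| 1 with hp | hp
      · have : √|p| ≤ 1 := Real.sqrt_le_one.2 hp
        nlinarith [Real.sqrt_nonneg |p|]
      · have h₃ : N ≤ 4 / (|p| / 2) := by
          refine norm_integral_cexp_quadratic_le_of_le_abs_deriv (by positivity) hαβ fun r hr => ?_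
          have h₄ : |2 * q * r| ≤ 4 * |q| := by
            rw [abs_mul, abs_mul, abs_two, abs_of_nonneg (by linarith [hr.1] : 0 ≤ r)]
            nlinarith [abs_nonneg q, hr.2]
          have := abs_sub_abs_le_abs_sub p (-(2 * q * r))
          rw [abs_neg, sub_neg_eq_add] at this
          linarith
        rw [le_div_iff₀ (by positivity)] at h₃
        have : √|p| ≤ |p| := by
          rw [Real.sqrt_le_left (by positivity)]
          nlinarith
        nlinarith
    have := mul_le_mul_of_nonneg_left (sqrt_one_add_le (abs_nonneg p)) hN0
    linarith

/-- Integration by parts against an amplitude that is bounded together with its derivative. -/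
theorem norm_integral_mul_le_of_norm_primitive_le {f f' : ℝ → ℝ} {e : ℝ → ℂ} {L M : ℝ}
    (he : Continuous e) (hf : ContinuousOn f (Set.Icc 1 2))
    (hf' : ∀ r ∈ Set.Ioo (1 : ℝ) 2, HasDerivAt f (f' r) r)
    (hfL : ∀ r ∈ Set.Icc (1 : ℝ) 2, |f r| ≤ L) (hfL' : ∀ r ∈ Set.Ioo (1 : ℝ) 2, |f' r| ≤ L)
    (hM : ∀ x ∈ Set.Icc (1 : ℝ) 2, ‖∫ r in (1 : ℝ)..x, e r‖ ≤ M) :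
    ‖∫ r in (1 : ℝ)..2, (f r : ℂ) * e r‖ ≤ 2 * L * M := by
  have h12 : (1 : ℝ) ≤ 2 := one_le_two
  have hM0 : 0 ≤ M := (norm_nonneg _).trans (hM 1 ⟨le_rfl, h12⟩)
  have hL0 : 0 ≤ L := (abs_nonneg _).trans (hfL 1 ⟨le_rfl, h12⟩)
  have hderiv : ∀ x, HasDerivAt (fun x => ∫ r in (1 : ℝ)..x, e r) (e x) x := fun x =>
    intervalIntegral.integral_hasDerivAt_right (he.intervalIntegrable _ _)
      he.aestronglyMeasurable.stronglyMeasurableAtFilter he.continuousAt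
  have hf'd : ∀ r ∈ Set.Ioo (1 : ℝ) 2, HasDerivAt f (deriv f r) r := fun r hr =>
    (hf' r hr).differentiableAt.hasDerivAt
  have hdL : ∀ r ∈ Set.Ioo (1 : ℝ) 2, |deriv f r| ≤ L := fun r hr => by
    rw [(hf' r hr).deriv]
    exact hfL' r hr
  have hint : IntervalIntegrable (fun r => ((deriv f r : ℝ) : ℂ)) volume 1 2 := by
    rw [intervalIntegrable_iff_integrableOn_Ioo_of_le h12]
    refine Integrable.of_bound
      (Complex.measurable_ofReal.comp (measurable_deriv f)).aestronglyMeasurable L ?_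
    filter_upwards [ae_restrict_mem measurableSet_Ioo] with r hr
    rw [Complex.norm_real]
    exact hdL r hr
  have hibp := intervalIntegral.integral_mul_deriv_eq_deriv_mul_of_hasDerivAt
    (a := (1 : ℝ)) (b := 2) (u := fun r => (f r : ℂ)) (u' := fun r => ((deriv f r : ℝ) : ℂ))
    (v := fun x => ∫ r in (1 : ℝ)..x, e r) (v' := e)
    (by rw [Set.uIcc_of_le h12]; exact Complex.continuous_ofReal.comp_continuousOn hf)
    (fun x _ => (hderiv x).continuousAt.continuousWithinAt)
    (by rw [min_eq_left h12, max_eq_right h12]; exact fun r hr => (hf'd r hr).ofReal_comp)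
    (fun x _ => hderiv x) hint (he.intervalIntegrable _ _)
  rw [hibp, intervalIntegral.integral_same, mul_zero, sub_zero]
  refine (norm_sub_le _ _).trans ?_
  have h₁ : ‖(f 2 : ℂ) * ∫ r in (1 : ℝ)..2, e r‖ ≤ L * M := by
    rw [norm_mul, Complex.norm_real]
    exact mul_le_mul (hfL 2 ⟨h12, le_rfl⟩) (hM 2 ⟨h12, le_rfl⟩) (norm_nonneg _) hL0
  have h₂ : ‖∫ x in (1 : ℝ)..2, ((deriv f x : ℝ) : ℂ) * ∫ r in (1 : ℝ)..x, e r‖ ≤ L * M := by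
    rw [intervalIntegral.integral_of_le h12, integral_Ioc_eq_integral_Ioo]
    have := norm_setIntegral_le_of_norm_le_const (μ := volume) (s := Set.Ioo (1 : ℝ) 2)
      (f := fun x => ((deriv f x : ℝ) : ℂ) * ∫ r in (1 : ℝ)..x, e r) (C := L * M)
      (by simp) fun x hx => by
        rw [norm_mul, Complex.norm_real]
        exact mul_le_mul (hdL x hx) (hM x ⟨hx.1.le, hx.2.le⟩) (norm_nonneg _) hL0
    refine this.trans (le_of_eq ?_)
    rw [Real.volume_real_Ioo_of_le h12]
    ring
  linarith

/-- Integration in polar coordinates. -/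
theorem integrable_and_integral_eq_integral_toSphere {E F : Type*} [NormedAddCommGroup E]
    [NormedSpace ℝ E] [FiniteDimensional ℝ E] [Nontrivial E] [MeasurableSpace E] [BorelSpace E]
    [NormedAddCommGroup F] [NormedSpace ℝ F] (μ : Measure E) [μ.IsAddHaarMeasure]
    {f : E → F} (hf : Integrable f μ) :
    Integrable (fun ω : Metric.sphere (0 : E) 1 =>
      ∫ r in Set.Ioi (0 : ℝ), r ^ (Module.finrank ℝ E - 1) • f (r • (ω : E))) μ.toSphere ∧
    ∫ x, f x ∂μ = ∫ ω : Metric.sphere (0 : E) 1,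
      (∫ r in Set.Ioi (0 : ℝ), r ^ (Module.finrank ℝ E - 1) • f (r • (ω : E))) ∂μ.toSphere := by
  set d := Module.finrank ℝ E - 1
  have hmp := μ.measurePreserving_homeomorphUnitSphereProd
  have hemb := (homeomorphUnitSphereProd E).measurableEmbedding
  set g : Metric.sphere (0 : E) 1 × Set.Ioi (0 : ℝ) → F := fun p => f ((p.2 : ℝ) • (p.1 : E))
  have hg : ∀ x : ({0}ᶜ : Set E), g (homeomorphUnitSphereProd E x) = f x := by
    intro x
    have h := congrArg Subtype.val ((homeomorphUnitSphereProd E).symm_apply_apply x)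
    rw [homeomorphUnitSphereProd_symm_apply_coe] at h
    simp only [g]
    rw [h]
  have hfg : Integrable g (μ.toSphere.prod (Measure.volumeIoiPow d)) := by
    rw [← hmp.integrable_comp_emb hemb]
    have : g ∘ homeomorphUnitSphereProd E = fun x : ({0}ᶜ : Set E) => f x := funext hg
    rw [this]
    exact (integrableOn_iff_comap_subtypeVal (measurableSet_singleton _).compl).1 hf.integrableOn
  have hinner : ∀ ω : Metric.sphere (0 : E) 1,
      ∫ r, g (ω, r) ∂(Measure.volumeIoiPow d) =
        ∫ r in Set.Ioi (0 : ℝ), r ^ d • f (r • (ω : E)) := by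
    intro ω
    rw [Measure.volumeIoiPow, integral_withDensity_eq_integral_toReal_smul
      (by fun_prop) (Filter.Eventually.of_forall fun _ => ENNReal.ofReal_lt_top)]
    rw [integral_subtype_comap measurableSet_Ioi
      (fun r : ℝ => (ENNReal.ofReal (r ^ d)).toReal • f (r • (ω : E)))]
    refine setIntegral_congr_fun measurableSet_Ioi fun r hr => ?_
    rw [ENNReal.toReal_ofReal (pow_nonneg (le_of_lt hr) _)]
  refine ⟨hfg.integral_prod_left.congr (Filter.Eventually.of_forall hinner), ?_⟩
  calc ∫ x, f x ∂μ = ∫ x : ({0}ᶜ : Set E), f x ∂(μ.comap (↑)) := by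
        rw [integral_subtype_comap (measurableSet_singleton _).compl, restrict_compl_singleton]
    _ = ∫ p, g p ∂(μ.toSphere.prod (Measure.volumeIoiPow d)) := by
        rw [← hmp.integral_comp hemb]
        exact integral_congr_ae (Filter.Eventually.of_forall fun x => (hg x).symm)
    _ = _ := by
        rw [integral_prod _ hfg]
        exact integral_congr_ae (Filter.Eventually.of_forall hinner)

theorem integrable_and_setIntegral_annulus_eq_integral_toSphere {E F : Type*}
    [NormedAddCommGroup E] [NormedSpace ℝ E] [FiniteDimensional ℝ E] [Nontrivial E]
    [MeasurableSpace E] [BorelSpace E] [NormedAddCommGroup F] [NormedSpace ℝ F] (μ : Measure E)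
    [μ.IsAddHaarMeasure] {f : E → F} (hf : IntegrableOn f {t : E | 1 ≤ ‖t‖ ∧ ‖t‖ ≤ 2} μ) :
    Integrable (fun ω : Metric.sphere (0 : E) 1 =>
      ∫ r in (1 : ℝ)..2, r ^ (Module.finrank ℝ E - 1) • f (r • (ω : E))) μ.toSphere ∧
    ∫ x in {t : E | 1 ≤ ‖t‖ ∧ ‖t‖ ≤ 2}, f x ∂μ = ∫ ω : Metric.sphere (0 : E) 1,
      (∫ r in (1 : ℝ)..2, r ^ (Module.finrank ℝ E - 1) • f (r • (ω : E))) ∂μ.toSphere := by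
  have hS : MeasurableSet {t : E | 1 ≤ ‖t‖ ∧ ‖t‖ ≤ 2} :=
    (measurableSet_le measurable_const measurable_norm).inter
      (measurableSet_le measurable_norm measurable_const)
  have h := integrable_and_integral_eq_integral_toSphere μ ((integrable_indicator_iff hS).2 hf)
  have hinner : ∀ ω : Metric.sphere (0 : E) 1,
      ∫ r in Set.Ioi (0 : ℝ), r ^ (Module.finrank ℝ E - 1) •
        {t : E | 1 ≤ ‖t‖ ∧ ‖t‖ ≤ 2}.indicator f (r • (ω : E)) =
      ∫ r in (1 : ℝ)..2, r ^ (Module.finrank ℝ E - 1) • f (r • (ω : E)) := by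
    intro ω
    have hsub : Set.Icc (1 : ℝ) 2 ⊆ Set.Ioi 0 := fun r hr => zero_lt_one.trans_le hr.1
    rw [intervalIntegral.integral_of_le one_le_two, ← integral_Icc_eq_integral_Ioc,
      ← Set.inter_eq_self_of_subset_right hsub, ← setIntegral_indicator measurableSet_Icc]
    refine setIntegral_congr_fun measurableSet_Ioi fun r hr => ?_
    have hω : ‖r • (ω : E)‖ = r := by
      rw [norm_smul, norm_eq_of_mem_sphere, mul_one, Real.norm_of_nonneg (le_of_lt hr)]
    by_cases h' : r ∈ Set.Icc (1 : ℝ) 2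
    · simp only [Set.indicator_of_mem h']
      rw [Set.indicator_of_mem]
      simpa [hω] using h'
    · simp only [Set.indicator_of_notMem h']
      rw [Set.indicator_of_notMem, smul_zero]
      simpa [hω] using h'
  rw [integral_indicator hS] at h
  simpa only [hinner] using h

theorem integral_one_div_sqrt_one_add_mul_abs_le {a : ℝ} (ha : 0 < a) :
    ∫ x in (-2 : ℝ)..2, 1 / √(1 + a * |x|) ≤ 8 / √a := by
  have hcont : Continuous fun x : ℝ => 1 / √(1 + a * |x|) :=
    Continuous.div continuous_const (by fun_prop) fun x => by positivity
  rw [← intervalIntegral.integral_add_adjacent_intervals (b := 0) (hcont.intervalIntegrable _ _)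
    (hcont.intervalIntegrable _ _)]
  have hneg : ∫ x in (-2 : ℝ)..0, 1 / √(1 + a * |x|) = ∫ x in (0 : ℝ)..2, 1 / √(1 + a * |x|) := by
    have := intervalIntegral.integral_comp_neg (a := 0) (b := 2) fun x : ℝ => 1 / √(1 + a * |x|)
    simpa using this.symm
  have hpos : ∫ x in (0 : ℝ)..2, 1 / √(1 + a * |x|) = 2 / a * (√(1 + a * 2) - 1) := by
    have hFTC := intervalIntegral.integral_eq_sub_of_hasDerivAt_of_le
      (f := fun x : ℝ => 2 / a * √(1 + a * x)) (f' := fun x => 1 / √(1 + a * |x|))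
      (zero_le_two (α := ℝ)) (by fun_prop) (fun x hx => by
        have h₀ : 0 < 1 + a * x := by have := mul_pos ha hx.1; linarith
        have h₁ : HasDerivAt (fun x : ℝ => 1 + a * x) a x := by
          simpa using ((hasDerivAt_id x).const_mul a).const_add 1
        have h₂ := (h₁.sqrt h₀.ne').const_mul (2 / a)
        refine h₂.congr_deriv ?_
        rw [abs_of_pos hx.1]
        field_simp) (hcont.intervalIntegrable _ _)
    rw [hFTC]
    simp
    ring
  rw [hneg, hpos]
  have h₁ : √(1 + a * 2) ≤ 1 + 2 * √a := by
    rw [Real.sqrt_le_left (by positivity)]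
    nlinarith [Real.sq_sqrt ha.le, Real.sqrt_nonneg a]
  have h₂ : 2 / a * (√(1 + a * 2) - 1) ≤ 2 / a * (2 * √a) := by
    gcongr
    linarith
  have h₃ : 2 / a * (2 * √a) = 4 / √a := by
    rw [eq_div_iff (by positivity), mul_assoc, mul_assoc, Real.mul_self_sqrt ha.le]
    field_simp
    norm_num
  have h₄ : 8 / √a = 4 / √a + 4 / √a := by ring
  linarith

theorem continuous_one_div_sqrt_one_add_abs_inner {E : Type*} [NormedAddCommGroup E]
    [InnerProductSpace ℝ E] (ξ : E) :
    Continuous fun t : E => 1 / √(1 + |inner ℝ t ξ|) :=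
  Continuous.div continuous_const (by fun_prop) fun t => by positivity

theorem isCompact_annulus (n : ℕ) :
    IsCompact {t : EuclideanSpace ℝ (Fin n) | 1 ≤ ‖t‖ ∧ ‖t‖ ≤ 2} := by
  refine (isCompact_closedBall (0 : EuclideanSpace ℝ (Fin n)) 2).of_isClosed_subset ?_ ?_
  · exact (isClosed_le continuous_const continuous_norm).inter
      (isClosed_le continuous_norm continuous_const)
  · intro t ht
    simpa using ht.2

theorem setIntegral_annulus_one_div_sqrt_one_add_abs_inner_le {n : ℕ} (hn : 0 < n)
    {ξ : EuclideanSpace ℝ (Fin n)} (hξ : ξ ≠ 0) :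
    ∫ t in {t : EuclideanSpace ℝ (Fin n) | 1 ≤ ‖t‖ ∧ ‖t‖ ≤ 2}, 1 / √(1 + |inner ℝ t ξ|) ≤
      8 * 4 ^ (n - 1) / √‖ξ‖ := by
  have hξ0 : 0 < ‖ξ‖ := norm_pos_iff.2 hξ
  let i₀ : Fin n := ⟨0, hn⟩
  obtain ⟨b, hb⟩ := Orthonormal.exists_orthonormalBasis_extension_of_card_eq
    (𝕜 := ℝ) (E := EuclideanSpace ℝ (Fin n)) (ι := Fin n) (by simp) (s := {i₀})
    (v := fun _ => (‖ξ‖⁻¹ • ξ)) (by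
      constructor
      · intro i
        simp [Set.domRestrict, norm_smul, hξ0.ne']
      · intro i j hij
        exact absurd (Subsingleton.elim i j) hij)
  have hbξ : ∀ t, inner ℝ t ξ = ‖ξ‖ * b.repr t i₀ := by
    intro t
    rw [b.repr_apply_apply, hb i₀ rfl, real_inner_smul_left, real_inner_comm]
    field_simp
  let w : Fin n → ℝ → ℝ := fun i x => (Set.Icc (-2 : ℝ) 2).indicator
    (fun x => if i = i₀ then 1 / √(1 + ‖ξ‖ * |x|) else 1) x
  have hw0 : ∀ i x, 0 ≤ w i x := by
    intro i x
    refine Set.indicator_nonneg (fun x _ => ?_) x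
    split_ifs <;> positivity
  have hwcont : ∀ i, Continuous fun x : ℝ => if i = i₀ then 1 / √(1 + ‖ξ‖ * |x|) else 1 := by
    intro i
    split_ifs
    · exact Continuous.div continuous_const (by fun_prop) fun x => by positivity
    · exact continuous_const
  have hwint : ∀ i, Integrable (w i) := fun i =>
    (integrable_indicator_iff measurableSet_Icc).2 (hwcont i).continuousOn.integrableOn_Icc
  have hwI : ∀ i, ∫ x, w i x = ∫ x in (-2 : ℝ)..2, if i = i₀ then 1 / √(1 + ‖ξ‖ * |x|) else 1 := by
    intro i
    rw [integral_indicator measurableSet_Icc, integral_Icc_eq_integral_Ioc,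
      intervalIntegral.integral_of_le (by norm_num)]
  have hmp : MeasurePreserving
      (fun t : EuclideanSpace ℝ (Fin n) => WithLp.ofLp (b.repr t)) volume volume :=
    (PiLp.volume_preserving_ofLp (Fin n)).comp b.measurePreserving_repr
  have hemb : MeasurableEmbedding
      (fun t : EuclideanSpace ℝ (Fin n) => WithLp.ofLp (b.repr t)) :=
    (MeasurableEquiv.toLp 2 (Fin n → ℝ)).symm.measurableEmbedding.comp
      b.repr.toHomeomorph.measurableEmbedding
  have hprod : Integrable fun x : Fin n → ℝ => ∏ i, w i (x i) := Integrable.fintype_prod hwint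
  have hprod' : Integrable fun t : EuclideanSpace ℝ (Fin n) => ∏ i, w i (b.repr t i) :=
    (hmp.integrable_comp_emb hemb).2 hprod
  calc ∫ t in {t : EuclideanSpace ℝ (Fin n) | 1 ≤ ‖t‖ ∧ ‖t‖ ≤ 2}, 1 / √(1 + |inner ℝ t ξ|)
      ≤ ∫ t in {t : EuclideanSpace ℝ (Fin n) | 1 ≤ ‖t‖ ∧ ‖t‖ ≤ 2}, ∏ i, w i (b.repr t i) := by
        refine setIntegral_mono_on ((continuous_one_div_sqrt_one_add_abs_inner ξ).continuousOn
          |>.integrableOn_compact (isCompact_annulus n)) hprod'.integrableOn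
          (isCompact_annulus n).measurableSet fun t ht => ?_
        have hmem : ∀ i, b.repr t i ∈ Set.Icc (-2 : ℝ) 2 := by
          intro i
          have h := PiLp.norm_apply_le (b.repr t) i
          rw [LinearIsometryEquiv.norm_map, Real.norm_eq_abs] at h
          exact abs_le.1 (h.trans ht.2)
        have hval : ∀ i, w i (b.repr t i) =
            if i = i₀ then 1 / √(1 + ‖ξ‖ * |b.repr t i₀|) else 1 := by
          intro i
          simp only [w, Set.indicator_of_mem (hmem i)]
          split_ifs with h
          · rw [h]
          · rfl
        simp only [hval]
        rw [Finset.prod_ite_eq', if_pos (Finset.mem_univ _), hbξ, abs_mul, abs_norm]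
    _ ≤ ∫ t : EuclideanSpace ℝ (Fin n), ∏ i, w i (b.repr t i) :=
        setIntegral_le_integral hprod' (Filter.Eventually.of_forall fun t =>
          Finset.prod_nonneg fun i _ => hw0 i _)
    _ = ∫ x : Fin n → ℝ, ∏ i, w i (x i) := hmp.integral_comp hemb fun x => ∏ i, w i (x i)
    _ = ∏ i, ∫ x, w i x := integral_fintype_prod_volume_eq_prod w
    _ = (∫ x in (-2 : ℝ)..2, 1 / √(1 + ‖ξ‖ * |x|)) * 4 ^ (n - 1) := by
        rw [← Finset.mul_prod_erase _ _ (Finset.mem_univ i₀), hwI]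
        have h4 : ∀ i ∈ Finset.univ.erase i₀, ∫ x, w i x = 4 := by
          intro i hi
          rw [hwI]
          simp only [if_neg (Finset.ne_of_mem_erase hi), intervalIntegral.integral_const]
          norm_num
        rw [Finset.prod_congr rfl h4, Finset.prod_const,
          Finset.card_erase_of_mem (Finset.mem_univ _)]
        simp
    _ ≤ 8 / √‖ξ‖ * 4 ^ (n - 1) := by
        gcongr
        exact integral_one_div_sqrt_one_add_mul_abs_le hξ0
    _ = _ := by ring

/-- The oscillatory integral along a ray is controlled by the primitives of the pure phase. -/
theorem norm_integral_ray_le {n : ℕ} (hn : 1 ≤ n) {A M : ℝ} (hA : 0 ≤ A)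
    {K : EuclideanSpace ℝ (Fin n) → ℝ}
    (hK : ContDiffOn ℝ 1 K {t : EuclideanSpace ℝ (Fin n) | 1 ≤ ‖t‖ ∧ ‖t‖ ≤ 2})
    (hKA : ∀ t ∈ {t : EuclideanSpace ℝ (Fin n) | 1 ≤ ‖t‖ ∧ ‖t‖ ≤ 2}, |K t| ≤ A / ‖t‖ ^ n)
    (hKA' : ∀ t ∈ {t : EuclideanSpace ℝ (Fin n) | 1 ≤ ‖t‖ ∧ ‖t‖ ≤ 2},
      ‖fderivWithin ℝ K {t : EuclideanSpace ℝ (Fin n) | 1 ≤ ‖t‖ ∧ ‖t‖ ≤ 2} t‖ ≤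
        A / ‖t‖ ^ (n + 1))
    {ω : EuclideanSpace ℝ (Fin n)} (hω : ‖ω‖ = 1) {e : ℝ → ℂ} (he : Continuous e)
    (hM : ∀ x ∈ Set.Icc (1 : ℝ) 2, ‖∫ r in (1 : ℝ)..x, e r‖ ≤ M) :
    ‖∫ r in (1 : ℝ)..2, ((r ^ (n - 1) * K (r • ω) : ℝ) : ℂ) * e r‖ ≤ 2 * (n * A) * M := by
  set S := {t : EuclideanSpace ℝ (Fin n) | 1 ≤ ‖t‖ ∧ ‖t‖ ≤ 2} with hS
  have hn1 : (1 : ℝ) ≤ n := by exact_mod_cast hn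
  have hnorm : ∀ r : ℝ, 1 ≤ r → ‖r • ω‖ = r := fun r hr => by
    rw [norm_smul, hω, mul_one, Real.norm_of_nonneg (by linarith)]
  have hmem : ∀ r ∈ Set.Icc (1 : ℝ) 2, r • ω ∈ S := fun r hr => by
    simpa [hS, hnorm r hr.1] using hr
  have hval : ∀ r ∈ Set.Icc (1 : ℝ) 2, r ^ (n - 1) * |K (r • ω)| ≤ A := by
    intro r hr
    have h := hKA _ (hmem r hr)
    rw [hnorm r hr.1] at h
    have hr0 : 0 < r := by linarith [hr.1]
    calc r ^ (n - 1) * |K (r • ω)| ≤ r ^ n * (A / r ^ n) := by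
          gcongr
          · exact hr.1
          · omega
      _ = A := by field_simp
  have hKle : ∀ r ∈ Set.Icc (1 : ℝ) 2, r ^ (n - 1 - 1) * |K (r • ω)| ≤ A := fun r hr => by
    refine le_trans ?_ (hval r hr)
    gcongr
    · exact hr.1
    · omega
  have hder : ∀ r ∈ Set.Ioo (1 : ℝ) 2, HasDerivAt (fun r : ℝ => K (r • ω))
      (fderivWithin ℝ K S (r • ω) ω) r := by
    intro r hr
    have hnhds : S ∈ nhds (r • ω) := by
      have hopen : IsOpen {t : EuclideanSpace ℝ (Fin n) | 1 < ‖t‖ ∧ ‖t‖ < 2} :=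
        (isOpen_lt continuous_const continuous_norm).inter
          (isOpen_lt continuous_norm continuous_const)
      refine Filter.mem_of_superset (hopen.mem_nhds ?_) fun t ht => ⟨ht.1.le, ht.2.le⟩
      simpa [hnorm r hr.1.le] using hr
    have hfd := ((hK.differentiableOn one_ne_zero) _
      (hmem r ⟨hr.1.le, hr.2.le⟩)).hasFDerivWithinAt.hasFDerivAt hnhds
    have hline : HasDerivAt (fun r : ℝ => r • ω) ω r := by
      simpa using (hasDerivAt_id r).smul_const ω
    exact hfd.comp_hasDerivAt r hline
  have hderle : ∀ r ∈ Set.Ioo (1 : ℝ) 2,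
      r ^ (n - 1) * |fderivWithin ℝ K S (r • ω) ω| ≤ A := by
    intro r hr
    have h := hKA' _ (hmem r ⟨hr.1.le, hr.2.le⟩)
    rw [hnorm r hr.1.le] at h
    have hr0 : 0 < r := by linarith [hr.1]
    have h' : |fderivWithin ℝ K S (r • ω) ω| ≤ A / r ^ (n + 1) := by
      refine ((fderivWithin ℝ K S (r • ω)).le_opNorm ω).trans ?_
      rwa [hω, mul_one]
    calc r ^ (n - 1) * |fderivWithin ℝ K S (r • ω) ω| ≤ r ^ (n + 1) * (A / r ^ (n + 1)) := by
          gcongr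
          · exact hr.1.le
          · omega
      _ = A := by field_simp
  refine norm_integral_mul_le_of_norm_primitive_le he
    (f := fun r => r ^ (n - 1) * K (r • ω))
    (f' := fun r => ((n - 1 : ℕ) * r ^ (n - 1 - 1)) * K (r • ω) +
      r ^ (n - 1) * fderivWithin ℝ K S (r • ω) ω) ?_ ?_ ?_ ?_ hM
  · exact (continuous_pow _).continuousOn.mul
      (hK.continuousOn.comp (by fun_prop) fun r hr => hmem r hr)
  · exact fun r hr => (hasDerivAt_pow (n - 1) r).mul (hder r hr)
  · intro r hr
    rw [abs_mul, abs_of_nonneg (pow_nonneg (by linarith [hr.1]) _)]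
    refine (hval r hr).trans ?_
    nlinarith
  · intro r hr
    have hr0 : 0 ≤ r := by linarith [hr.1]
    refine (abs_add_le _ _).trans ?_
    rw [abs_mul, abs_mul, abs_mul, abs_of_nonneg (pow_nonneg hr0 _),
      abs_of_nonneg (pow_nonneg hr0 _), Nat.abs_cast, Nat.cast_sub hn, Nat.cast_one, mul_assoc]
    have h₁ := mul_le_mul_of_nonneg_left (hKle r ⟨hr.1.le, hr.2.le⟩) (sub_nonneg.2 hn1)
    have h₂ := hderle r hr
    linarith

theorem integral_toSphere_one_div_sqrt_one_add_abs_inner_le {n : ℕ} (hn : 0 < n)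
    {ξ : EuclideanSpace ℝ (Fin n)} (hξ : ξ ≠ 0) :
    ∫ ω : Metric.sphere (0 : EuclideanSpace ℝ (Fin n)) 1,
        1 / √(1 + |inner ℝ (ω : EuclideanSpace ℝ (Fin n)) ξ|)
        ∂(volume : Measure (EuclideanSpace ℝ (Fin n))).toSphere ≤
      √2 * (8 * 4 ^ (n - 1)) / √‖ξ‖ := by
  have : Nonempty (Fin n) := ⟨⟨0, hn⟩⟩
  have hcont := continuous_one_div_sqrt_one_add_abs_inner ξ
  obtain ⟨hint, heq⟩ := integrable_and_setIntegral_annulus_eq_integral_toSphere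
    (volume : Measure (EuclideanSpace ℝ (Fin n)))
    (hcont.continuousOn.integrableOn_compact (isCompact_annulus n))
  have hle := setIntegral_annulus_one_div_sqrt_one_add_abs_inner_le hn hξ
  rw [heq] at hle
  have hpt : ∀ ω : Metric.sphere (0 : EuclideanSpace ℝ (Fin n)) 1,
      1 / √(1 + |inner ℝ (ω : EuclideanSpace ℝ (Fin n)) ξ|) ≤
        √2 * ∫ r in (1 : ℝ)..2, r ^ (Module.finrank ℝ (EuclideanSpace ℝ (Fin n)) - 1) •
          (1 / √(1 + |inner ℝ (r • (ω : EuclideanSpace ℝ (Fin n))) ξ|)) := by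
    intro ω
    set x := |inner ℝ (ω : EuclideanSpace ℝ (Fin n)) ξ|
    have hx : 0 ≤ x := abs_nonneg _
    have hmono : ∫ _ in (1 : ℝ)..2, 1 / (√2 * √(1 + x)) ≤
        ∫ r in (1 : ℝ)..2, r ^ (Module.finrank ℝ (EuclideanSpace ℝ (Fin n)) - 1) •
          (1 / √(1 + |inner ℝ (r • (ω : EuclideanSpace ℝ (Fin n))) ξ|)) := by
      refine intervalIntegral.integral_mono_on one_le_two (by simp)
        (Continuous.intervalIntegrable
          ((continuous_pow _).smul (hcont.comp (by fun_prop))) _ _) fun r hr => ?_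
      have hr0 : 0 ≤ r := by linarith [hr.1]
      rw [real_inner_smul_left, abs_mul, abs_of_nonneg hr0, smul_eq_mul,
        ← Real.sqrt_mul zero_le_two]
      calc 1 / √(2 * (1 + x)) ≤ 1 / √(1 + r * x) := by
            gcongr
            nlinarith [hr.2]
        _ ≤ _ := le_mul_of_one_le_left (by positivity) (one_le_pow₀ hr.1)
    have hs : (0 : ℝ) < √2 := by positivity
    rw [intervalIntegral.integral_const, smul_eq_mul] at hmono
    calc 1 / √(1 + x) = √2 * ((2 - 1) * (1 / (√2 * √(1 + x)))) := by field_simp; norm_num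
      _ ≤ _ := by gcongr
  have hcS : Continuous fun ω : Metric.sphere (0 : EuclideanSpace ℝ (Fin n)) 1 =>
      1 / √(1 + |inner ℝ (ω : EuclideanSpace ℝ (Fin n)) ξ|) := hcont.comp continuous_subtype_val
  refine (integral_mono (hcS.integrable_of_hasCompactSupport
    (HasCompactSupport.of_compactSpace _)) (hint.const_mul √2) hpt).trans ?_
  rw [integral_const_mul, mul_div_assoc]
  gcongr

/-- Oscillatory integral estimate over the annulus `{1 ≤ |t| ≤ 2}` along the paraboloid:
if `K` is `C¹` on the annulus with `|K(t)| ≤ A|t|^{-n}` and `|∇K(t)| ≤ A|t|^{-n-1}`, then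
`|∫_{1≤|t|≤2} K(t) e^{-2πi(t·ξ' + |t|²ξ_{n+1})} dt| ≤ C (|ξ'| + |ξ_{n+1}|^{1/2})^{-1/2}`,
with `C` depending only on `n` and `A`. -/
theorem annulus_oscillatory_integral_decay (n : ℕ) (hn : 2 ≤ n) (A : ℝ) (hA : 0 < A) :
    ∃ C : ℝ, 0 < C ∧ ∀ K : EuclideanSpace ℝ (Fin n) → ℝ,
      ContDiffOn ℝ 1 K {t : EuclideanSpace ℝ (Fin n) | 1 ≤ ‖t‖ ∧ ‖t‖ ≤ 2} →
      (∀ t ∈ {t : EuclideanSpace ℝ (Fin n) | 1 ≤ ‖t‖ ∧ ‖t‖ ≤ 2}, |K t| ≤ A / ‖t‖ ^ n) →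
      (∀ t ∈ {t : EuclideanSpace ℝ (Fin n) | 1 ≤ ‖t‖ ∧ ‖t‖ ≤ 2},
        ‖fderivWithin ℝ K {t : EuclideanSpace ℝ (Fin n) | 1 ≤ ‖t‖ ∧ ‖t‖ ≤ 2} t‖ ≤
          A / ‖t‖ ^ (n + 1)) →
      ∀ (ξ' : EuclideanSpace ℝ (Fin n)) (ξlast : ℝ),
        0 < ‖ξ'‖ + |ξlast| ^ ((1 : ℝ) / 2) →
        ‖∫ t in {t : EuclideanSpace ℝ (Fin n) | 1 ≤ ‖t‖ ∧ ‖t‖ ≤ 2},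
            (K t : ℂ) * Complex.exp ((-2 * (Real.pi : ℂ) * Complex.I) *
              ((((∑ i, t i * ξ' i) + ‖t‖ ^ 2 * ξlast : ℝ)) : ℂ))‖ ≤
          C * (‖ξ'‖ + |ξlast| ^ ((1 : ℝ) / 2)) ^ (-(1 : ℝ) / 2) := by
  have : Nonempty (Fin n) := ⟨⟨0, by omega⟩⟩
  set σ := (volume : Measure (EuclideanSpace ℝ (Fin n))).toSphere
  set D : ℝ := √2 * (8 * 4 ^ (n - 1)) with hD
  have hD0 : 0 < D := by positivity
  set B : ℝ := 2 * (n * A) * 21 with hB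
  have hB0 : 0 < B := by
    have : (0 : ℝ) < n := by exact_mod_cast (by omega : 0 < n)
    positivity
  refine ⟨B * (σ.real Set.univ + D) * √2, by positivity, ?_⟩
  intro K hK hKA hKA' ξ l hR
  have hinner : ∀ t : EuclideanSpace ℝ (Fin n), ∑ i, t i * ξ i = inner ℝ t ξ := fun t => by
    simp [PiLp.inner_apply, mul_comm]
  rw [← Real.sqrt_eq_rpow] at hR ⊢
  rw [neg_div, Real.rpow_neg hR.le, ← Real.sqrt_eq_rpow]
  simp only [hinner]
  set R := ‖ξ‖ + √|l| with hRdef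
  have hKint : IntegrableOn (fun t : EuclideanSpace ℝ (Fin n) =>
      (K t : ℂ) * Complex.exp ((-2 * (Real.pi : ℂ) * Complex.I) *
        ((inner ℝ t ξ + ‖t‖ ^ 2 * l : ℝ) : ℂ))) {t | 1 ≤ ‖t‖ ∧ ‖t‖ ≤ 2} :=
    ContinuousOn.integrableOn_compact (isCompact_annulus n)
      ((Complex.continuous_ofReal.comp_continuousOn hK.continuousOn).mul
        (Continuous.continuousOn (by fun_prop)))
  rw [(integrable_and_setIntegral_annulus_eq_integral_toSphere volume hKint).2]
  have hray : ∀ (ω : Metric.sphere (0 : EuclideanSpace ℝ (Fin n)) 1) (M : ℝ),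
      (∀ x ∈ Set.Icc (1 : ℝ) 2, ‖∫ r in (1 : ℝ)..x, Complex.exp (Complex.I *
        ((-2 * Real.pi * inner ℝ (ω : EuclideanSpace ℝ (Fin n)) ξ * r +
          -2 * Real.pi * l * r ^ 2 : ℝ) : ℂ))‖ ≤ 21 * M) →
      ‖∫ r in (1 : ℝ)..2, r ^ (Module.finrank ℝ (EuclideanSpace ℝ (Fin n)) - 1) •
        ((K (r • (ω : EuclideanSpace ℝ (Fin n))) : ℂ) *
          Complex.exp ((-2 * (Real.pi : ℂ) * Complex.I) *
            ((inner ℝ (r • (ω : EuclideanSpace ℝ (Fin n))) ξ +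
              ‖r • (ω : EuclideanSpace ℝ (Fin n))‖ ^ 2 * l : ℝ) : ℂ)))‖ ≤ B * M := by
    intro ω M hM
    have hω : ‖(ω : EuclideanSpace ℝ (Fin n))‖ = 1 := norm_eq_of_mem_sphere ω
    have h := norm_integral_ray_le (by omega) hA.le hK hKA hKA' hω
      (continuous_cexp_quadratic (-2 * Real.pi * inner ℝ (ω : EuclideanSpace ℝ (Fin n)) ξ)
        (-2 * Real.pi * l)) hM
    refine le_trans (le_of_eq ?_) (h.trans (le_of_eq (by rw [hB]; ring)))
    congr 1
    refine intervalIntegral.integral_congr fun r _ => ?_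
    simp only [finrank_euclideanSpace_fin, real_inner_smul_left, norm_smul, hω,
      Complex.real_smul, mul_one, Real.norm_eq_abs, sq_abs]
    push_cast
    rw [← mul_assoc]
    congr 2
    ring
  have hsqrt : ∀ x : ℝ, √(1 + |x|) ≤ √(1 + |-2 * Real.pi * x|) := fun x => by
    refine Real.sqrt_le_sqrt ((add_le_add_iff_left 1).2 ?_)
    rw [abs_mul]
    refine le_mul_of_one_le_left (abs_nonneg _) ?_
    rw [abs_mul, abs_neg, abs_two, abs_of_pos Real.pi_pos]
    linarith [Real.pi_gt_three]
  have hσ0 : 0 ≤ σ.real Set.univ := measureReal_nonneg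
  have hRs : 0 < √R := Real.sqrt_pos.2 hR
  rcases le_or_gt ‖ξ‖ √|l| with hcase | hcase
  · have hbound := norm_integral_le_of_norm_le_const (μ := σ) (Filter.Eventually.of_forall
      fun ω => hray ω (1 / √(1 + |l|)) fun x hx => by
        refine (norm_integral_cexp_quadratic_le_of_quadratic_coeff le_rfl hx.1 hx.2).trans ?_
        rw [mul_one_div]
        exact div_le_div₀ (by norm_num) (by norm_num) (by positivity) (hsqrt l))
    refine hbound.trans ?_
    have hRl : √R ≤ √2 * √(1 + |l|) := by
      rw [← Real.sqrt_mul zero_le_two]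
      refine Real.sqrt_le_sqrt ?_
      nlinarith [Real.sq_sqrt (abs_nonneg l), Real.sqrt_nonneg |l|, sq_nonneg (√|l| - 1)]
    have h₁ : 1 / √(1 + |l|) ≤ √2 * (√R)⁻¹ := by
      rw [← div_eq_mul_inv, div_le_div_iff₀ (by positivity) hRs, one_mul]
      exact hRl
    calc B * (1 / √(1 + |l|)) * σ.real Set.univ
        ≤ B * (√2 * (√R)⁻¹) * (σ.real Set.univ + D) := by
          gcongr
          linarith
      _ = _ := by ring
  · have hξ : ξ ≠ 0 := norm_pos_iff.1 ((Real.sqrt_nonneg _).trans_lt hcase)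
    have hξ0 : 0 < ‖ξ‖ := norm_pos_iff.2 hξ
    have hcS : Continuous fun ω : Metric.sphere (0 : EuclideanSpace ℝ (Fin n)) 1 =>
        1 / √(1 + |inner ℝ (ω : EuclideanSpace ℝ (Fin n)) ξ|) :=
      (continuous_one_div_sqrt_one_add_abs_inner ξ).comp continuous_subtype_val
    have hbound := norm_integral_le_of_norm_le (μ := σ)
      ((hcS.integrable_of_hasCompactSupport (HasCompactSupport.of_compactSpace _)).const_mul B)
      (Filter.Eventually.of_forall fun ω => hray ω _ fun x hx => by
        refine (norm_integral_cexp_quadratic_le_of_linear_coeff le_rfl hx.1 hx.2).trans ?_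
        rw [mul_one_div]
        exact div_le_div₀ (by norm_num) le_rfl (by positivity) (hsqrt _))
    refine hbound.trans ?_
    rw [integral_const_mul]
    have h₁ := integral_toSphere_one_div_sqrt_one_add_abs_inner_le (by omega) hξ
    have h₂ : 1 / √‖ξ‖ ≤ √2 * (√R)⁻¹ := by
      rw [← div_eq_mul_inv, div_le_div_iff₀ (by positivity) hRs, one_mul,
        ← Real.sqrt_mul zero_le_two]
      refine Real.sqrt_le_sqrt ?_
      linarith
    calc _ ≤ B * (D / √‖ξ‖) := mul_le_mul_of_nonneg_left h₁ hB0.le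
      _ = B * D * (1 / √‖ξ‖) := by ring
      _ ≤ B * (σ.real Set.univ + D) * (√2 * (√R)⁻¹) := by
          gcongr
          linarith
      _ = _ := by ring
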